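/- arXiv:2111.07720 — 17 statements merged into one kernel-verified Lean document; each statement's English description precedes it below -/
import Mathlib

section
/- Exactly one of the following two conditions holds: (i) for every p' ∈ conv(𝒜) there exists v ∈ 𝒜 such that ‖p' − v‖ ≥ ‖p − v‖; (ii) there exists p' ∈ conv(𝒜) such that ‖p' − v‖ < ‖p − v‖ for every v ∈ 𝒜. Moreover, condition (i) holds if and only if p ∈ conv(𝒜), and condition (ii) holds if and only if p ∉ conv(𝒜). (Distance duality theorem.) -/
section DistanceDuality

variable {E : Type*} [NormedAddCommGroup E] [InnerProductSpace ℝ E]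

theorem convex_setOf_norm_sub_lt_norm_sub (p q : E) : Convex ℝ {x : E | ‖q - x‖ < ‖p - x‖} := by
  have h_halfspace : {x : E | ‖q - x‖ < ‖p - x‖} =
      {x : E | (‖q‖ ^ 2 - ‖p‖ ^ 2) / 2 < inner ℝ (q - p) x} := by
    ext x
    simp only [Set.mem_ofPred_eq]
    rw [← sq_lt_sq₀ (norm_nonneg _) (norm_nonneg _), norm_sub_sq_real, norm_sub_sq_real,
      inner_sub_left]
    constructor <;> intro h <;> linarith
  rw [h_halfspace]
  exact convex_halfSpace_gt (innerₛₗ ℝ (q - p)).isLinear _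

theorem notMem_convexHull_of_forall_norm_sub_lt {s : Set E} {p q : E}
    (h : ∀ v ∈ s, ‖q - v‖ < ‖p - v‖) : p ∉ convexHull ℝ s := by
  intro hp
  have hlt : ‖q - p‖ < ‖p - p‖ :=
    convexHull_min h (convex_setOf_norm_sub_lt_norm_sub p q) hp
  rw [sub_self, norm_zero] at hlt
  exact (norm_nonneg _).not_gt hlt

/-- The nearest point to `p` in `K` is strictly closer than `p` to every point of `K`. -/
theorem Convex.exists_forall_norm_sub_lt_of_notMem {K : Set E} (hK : Convex ℝ K)
    (hc : IsComplete K) (hne : K.Nonempty) {p : E} (hp : p ∉ K) :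
    ∃ q ∈ K, ∀ v ∈ K, ‖q - v‖ < ‖p - v‖ := by
  obtain ⟨q, hq, hmin⟩ := exists_norm_eq_iInf_of_complete_convex hne hc hK p
  refine ⟨q, hq, fun v hv => ?_⟩
  have hinner := (norm_eq_iInf_iff_real_inner_le_zero hK hq).1 hmin v hv
  have hpos : 0 < ‖p - q‖ := norm_pos_iff.2 (sub_ne_zero.2 fun h => hp (h ▸ hq))
  have hexp := norm_sub_sq_real (p - q) (v - q)
  rw [sub_sub_sub_cancel_right, norm_sub_rev v q] at hexp
  refine lt_of_pow_lt_pow_left₀ 2 (norm_nonneg _) ?_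
  nlinarith

end DistanceDuality

/-- **Distance duality theorem** (Kalantari). For a nonempty finite set `𝒜 ⊂ ℝ^m` and a
query point `p`, exactly one of the following holds:
(i) every `p' ∈ conv(𝒜)` admits `v ∈ 𝒜` with `‖p' - v‖ ≥ ‖p - v‖`;
(ii) some `p' ∈ conv(𝒜)` satisfies `‖p' - v‖ < ‖p - v‖` for all `v ∈ 𝒜`.
Moreover (i) holds iff `p ∈ conv(𝒜)` and (ii) holds iff `p ∉ conv(𝒜)`. -/
theorem distance_duality {m : ℕ} (𝒜 : Finset (EuclideanSpace ℝ (Fin m))) (h𝒜 : 𝒜.Nonempty)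
    (p : EuclideanSpace ℝ (Fin m)) :
    (Xor'
      (∀ p' ∈ convexHull ℝ (𝒜 : Set (EuclideanSpace ℝ (Fin m))),
        ∃ v ∈ 𝒜, ‖p - v‖ ≤ ‖p' - v‖)
      (∃ p' ∈ convexHull ℝ (𝒜 : Set (EuclideanSpace ℝ (Fin m))),
        ∀ v ∈ 𝒜, ‖p' - v‖ < ‖p - v‖)) ∧
    ((∀ p' ∈ convexHull ℝ (𝒜 : Set (EuclideanSpace ℝ (Fin m))),
        ∃ v ∈ 𝒜, ‖p - v‖ ≤ ‖p' - v‖) ↔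
      p ∈ convexHull ℝ (𝒜 : Set (EuclideanSpace ℝ (Fin m)))) ∧
    ((∃ p' ∈ convexHull ℝ (𝒜 : Set (EuclideanSpace ℝ (Fin m))),
        ∀ v ∈ 𝒜, ‖p' - v‖ < ‖p - v‖) ↔
      p ∉ convexHull ℝ (𝒜 : Set (EuclideanSpace ℝ (Fin m)))) := by
  have hii : (∃ p' ∈ convexHull ℝ (𝒜 : Set (EuclideanSpace ℝ (Fin m))),
      ∀ v ∈ 𝒜, ‖p' - v‖ < ‖p - v‖) ↔
      p ∉ convexHull ℝ (𝒜 : Set (EuclideanSpace ℝ (Fin m))) := by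
    constructor
    · rintro ⟨q, -, hq⟩
      exact notMem_convexHull_of_forall_norm_sub_lt hq
    · intro hp
      obtain ⟨q, hq, hlt⟩ := (convex_convexHull ℝ _).exists_forall_norm_sub_lt_of_notMem
        (𝒜.finite_toSet.isCompact_convexHull ℝ).isComplete (convexHull_nonempty_iff.2 h𝒜) hp
      exact ⟨q, hq, fun v hv => hlt v (subset_convexHull ℝ _ hv)⟩
  have hi : (∀ p' ∈ convexHull ℝ (𝒜 : Set (EuclideanSpace ℝ (Fin m))),
      ∃ v ∈ 𝒜, ‖p - v‖ ≤ ‖p' - v‖) ↔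
      p ∈ convexHull ℝ (𝒜 : Set (EuclideanSpace ℝ (Fin m))) := by
    rw [← not_iff_not, ← hii]
    push Not
    rfl
  refine ⟨?_, hi, hii⟩
  rw [hi, hii]
  exact xor_not_right.2 Iff.rfl
end

section
/- If p' ∈ conv(𝒜) is a witness, i.e. ‖p' − v‖ < ‖p − v‖ for every v ∈ 𝒜, then p ≠ p' and for every y ∈ conv(𝒜) one has (p − p')ᵀ y < (p − p')ᵀ (p + p')/2 < (p − p')ᵀ p. In particular the orthogonal bisecting hyperplane H = {y ∈ ℝ^m : (p − p')ᵀ y = (p − p')ᵀ (p + p')/2} strictly separates p from conv(𝒜), and hence p ∉ conv(𝒜). -/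
open scoped RealInnerProductSpace

/-- A point `v` is strictly closer to `p'` than to `p` iff it lies strictly on the `p'` side of the
orthogonal hyperplane bisecting the segment from `p` to `p'` at its midpoint. -/
lemma norm_sub_lt_norm_sub_iff_inner_lt {E : Type*} [NormedAddCommGroup E]
    [InnerProductSpace ℝ E] (p p' v : E) :
    ‖p' - v‖ < ‖p - v‖ ↔ ⟪p - p', v⟫ < ⟪p - p', (2 : ℝ)⁻¹ • (p + p')⟫ := by
  rw [← sq_lt_sq₀ (norm_nonneg _) (norm_nonneg _), norm_sub_sq_real, norm_sub_sq_real,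
    real_inner_smul_right, inner_sub_left, inner_add_right, inner_sub_left, inner_sub_left,
    real_inner_self_eq_norm_sq, real_inner_self_eq_norm_sq, real_inner_comm p p']
  constructor <;> intro h <;> linarith

/-- If `p' ∈ conv(𝒜)` is a witness, i.e. `‖p' - v‖ < ‖p - v‖` for every `v ∈ 𝒜`, then
`p ≠ p'` and for every `y ∈ conv(𝒜)` one has
`⟪p - p', y⟫ < ⟪p - p', (p + p')/2⟫ < ⟪p - p', p⟫`; in particular the orthogonal bisecting
hyperplane of the segment `[p, p']` strictly separates `p` from `conv(𝒜)`, and `p ∉ conv(𝒜)`. -/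
theorem witness_separates {m : ℕ} (𝒜 : Finset (EuclideanSpace ℝ (Fin m))) (h𝒜 : 𝒜.Nonempty)
    (p p' : EuclideanSpace ℝ (Fin m))
    (hp' : p' ∈ convexHull ℝ (𝒜 : Set (EuclideanSpace ℝ (Fin m))))
    (hwit : ∀ v ∈ 𝒜, ‖p' - v‖ < ‖p - v‖) :
    p ≠ p' ∧
    (∀ y ∈ convexHull ℝ (𝒜 : Set (EuclideanSpace ℝ (Fin m))),
      ⟪p - p', y⟫ < ⟪p - p', (2 : ℝ)⁻¹ • (p + p')⟫ ∧
      ⟪p - p', (2 : ℝ)⁻¹ • (p + p')⟫ < ⟪p - p', p⟫) ∧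
    p ∉ convexHull ℝ (𝒜 : Set (EuclideanSpace ℝ (Fin m))) := by
  obtain ⟨v, hv⟩ := h𝒜
  have hne : p ≠ p' := by
    rintro rfl
    exact lt_irrefl _ (hwit v hv)
  have hleft : ∀ y ∈ convexHull ℝ (𝒜 : Set (EuclideanSpace ℝ (Fin m))),
      ⟪p - p', y⟫ < ⟪p - p', (2 : ℝ)⁻¹ • (p + p')⟫ :=
    convexHull_min (fun v hv => (norm_sub_lt_norm_sub_iff_inner_lt p p' v).1 (hwit v hv))
      (convex_halfSpace_lt (innerₛₗ ℝ (p - p')).isLinear _)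
  have hright : ⟪p - p', (2 : ℝ)⁻¹ • (p + p')⟫ < ⟪p - p', p⟫ := by
    have hpos : 0 < ⟪p - p', p - p'⟫ := real_inner_self_pos.2 (sub_ne_zero.2 hne)
    rw [inner_sub_right] at hpos
    rw [real_inner_smul_right, inner_add_right]
    linarith
  exact ⟨hne, fun y hy => ⟨hleft y hy, hright⟩, fun hp => lt_asymm (hleft p hp) hright⟩
end

section
/- If p' ∈ conv(𝒜) is a witness, i.e. ‖p' − v‖ < ‖p − v‖ for every v ∈ 𝒜, then the distance Δ = inf{‖y − p‖ : y ∈ conv(𝒜)} from p to conv(𝒜) satisfies (1/2)‖p' − p‖ ≤ Δ ≤ ‖p' − p‖. Thus a witness approximates the distance from p to conv(𝒜) within a factor of two. -/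
open scoped InnerProductSpace in
/-- The points strictly closer to `a` than to `b` form an open half-space. -/
theorem norm_sub_lt_norm_sub_iff_inner {E : Type*} [NormedAddCommGroup E] [InnerProductSpace ℝ E]
    (a b y : E) : ‖a - y‖ < ‖b - y‖ ↔ ⟪b - a, y⟫_ℝ < (‖b‖ ^ 2 - ‖a‖ ^ 2) / 2 := by
  rw [← sq_lt_sq₀ (norm_nonneg _) (norm_nonneg _), norm_sub_sq_real, norm_sub_sq_real,
    inner_sub_left]
  constructor <;> intro h <;> linarith

theorem convex_setOf_norm_sub_lt_norm_sub_s2 {E : Type*} [NormedAddCommGroup E]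
    [InnerProductSpace ℝ E] (a b : E) : Convex ℝ {y : E | ‖a - y‖ < ‖b - y‖} := by
  simp only [norm_sub_lt_norm_sub_iff_inner]
  exact convex_halfSpace_lt (innerₛₗ ℝ (b - a)).isLinear _

/-- A witness approximates the distance from `p` to `conv(𝒜)` within a factor of two:
if `p' ∈ conv(𝒜)` satisfies `‖p' - v‖ < ‖p - v‖` for every `v ∈ 𝒜`, then the distance
`Δ = inf {‖y - p‖ : y ∈ conv(𝒜)}` satisfies `(1/2)‖p' - p‖ ≤ Δ ≤ ‖p' - p‖`. -/
theorem witness_dist_estimate {m : ℕ} (𝒜 : Finset (EuclideanSpace ℝ (Fin m))) (h𝒜 : 𝒜.Nonempty)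
    (p p' : EuclideanSpace ℝ (Fin m))
    (hp' : p' ∈ convexHull ℝ (𝒜 : Set (EuclideanSpace ℝ (Fin m))))
    (hwit : ∀ v ∈ 𝒜, ‖p' - v‖ < ‖p - v‖) :
    (1 / 2) * ‖p' - p‖ ≤ Metric.infDist p (convexHull ℝ (𝒜 : Set (EuclideanSpace ℝ (Fin m)))) ∧
    Metric.infDist p (convexHull ℝ (𝒜 : Set (EuclideanSpace ℝ (Fin m)))) ≤ ‖p' - p‖ := by
  refine ⟨(Metric.le_infDist ⟨p', hp'⟩).2 fun y hy => ?_, ?_⟩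
  · have hlt : ‖p' - y‖ < ‖p - y‖ :=
      convexHull_min hwit (convex_setOf_norm_sub_lt_norm_sub_s2 p' p) hy
    have htri := dist_triangle_right p' p y
    simp only [dist_eq_norm] at htri ⊢
    linarith
  · rw [← dist_eq_norm, dist_comm]
    exact Metric.infDist_le_dist_of_mem hp'
end

section
/- Let p, p_k, v ∈ ℝ^m satisfy p_k ≠ p, ‖v − p‖ ≤ ‖v − p_k‖ (v is a pivot) and ‖p_k − p‖ ≤ ‖v − p‖. Then v ≠ p_k, the quantity γ̄ = −(p_k − p)ᵀ(v − p_k)/‖v − p_k‖² lies in the interval (0, 1], γ̄ minimizes the function γ ↦ ‖(1−γ)p_k + γ v − p‖ over [0, 1], and the point p_{k+1} = (1 − γ̄)p_k + γ̄ v satisfies ‖p_{k+1} − p‖ < ‖p_k − p‖. -/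
open scoped RealInnerProductSpace

/-- Completing the square along the line `t ↦ a + t • d` around its point closest to the origin. -/
theorem norm_add_smul_sq_eq {E : Type*} [NormedAddCommGroup E] [InnerProductSpace ℝ E]
    (a d : E) {s : ℝ} (hs : s * ‖d‖ ^ 2 = -⟪a, d⟫) (t : ℝ) :
    ‖a + t • d‖ ^ 2 = ‖a + s • d‖ ^ 2 + (t - s) ^ 2 * ‖d‖ ^ 2 := by
  simp only [norm_add_sq_real, inner_smul_right, norm_smul, mul_pow, Real.norm_eq_abs, sq_abs]
  linear_combination (2 * t - 2 * s) * hs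

/-- The exact line-search step of the Triangle Algorithm. If `p_k ≠ p`, `v` is a pivot
(`‖v - p‖ ≤ ‖v - p_k‖`) and `‖p_k - p‖ ≤ ‖v - p‖`, then `v ≠ p_k`, the step-size
`γ̄ = -⟪p_k - p, v - p_k⟫ / ‖v - p_k‖²` lies in `(0, 1]`, it minimizes
`γ ↦ ‖(1 - γ)p_k + γv - p‖` over `[0, 1]`, and the next iterate
`p_{k+1} = (1 - γ̄)p_k + γ̄v` satisfies `‖p_{k+1} - p‖ < ‖p_k - p‖`. -/
theorem triangle_step {m : ℕ} (p pk v : EuclideanSpace ℝ (Fin m))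
    (hne : pk ≠ p) (hpivot : ‖v - p‖ ≤ ‖v - pk‖) (hclosest : ‖pk - p‖ ≤ ‖v - p‖)
    (γbar : ℝ) (hγbar : γbar = -⟪pk - p, v - pk⟫ / ‖v - pk‖ ^ 2) :
    v ≠ pk ∧
    γbar ∈ Set.Ioc (0 : ℝ) 1 ∧
    (∀ γ ∈ Set.Icc (0 : ℝ) 1,
      ‖(1 - γbar) • pk + γbar • v - p‖ ≤ ‖(1 - γ) • pk + γ • v - p‖) ∧
    ‖(1 - γbar) • pk + γbar • v - p‖ < ‖pk - p‖ := by
  have hsplit : v - p = (pk - p) + (v - pk) := by abel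
  have hexp := norm_add_sq_real (pk - p) (v - pk)
  rw [← hsplit] at hexp
  have ha : 0 < ‖pk - p‖ := norm_pos_iff.mpr (sub_ne_zero.mpr hne)
  have hd : 0 < ‖v - pk‖ := by linarith
  have hpivot_sq : ‖v - p‖ ^ 2 ≤ ‖v - pk‖ ^ 2 := by gcongr
  have hclosest_sq : ‖pk - p‖ ^ 2 ≤ ‖v - p‖ ^ 2 := by gcongr
  have ha_sq : 0 < ‖pk - p‖ ^ 2 := by positivity
  have hd_sq : 0 < ‖v - pk‖ ^ 2 := by positivity
  have hγ_pos : 0 < γbar := by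
    rw [hγbar]
    exact div_pos (by linarith) hd_sq
  have hγ_le : γbar ≤ 1 := by
    rw [hγbar, div_le_one hd_sq]
    linarith
  have hline (t : ℝ) : (1 - t) • pk + t • v - p = (pk - p) + t • (v - pk) := by module
  have hsquare := norm_add_smul_sq_eq (pk - p) (v - pk)
    (show γbar * ‖v - pk‖ ^ 2 = -⟪pk - p, v - pk⟫ by rw [hγbar, div_mul_cancel₀ _ hd_sq.ne'])
  refine ⟨sub_ne_zero.mp (norm_pos_iff.mp hd), ⟨hγ_pos, hγ_le⟩, fun γ _ => ?_, ?_⟩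
  · rw [hline, hline]
    refine le_of_pow_le_pow_left₀ two_ne_zero (norm_nonneg _) ?_
    rw [hsquare γ]
    exact le_add_of_nonneg_right (by positivity)
  · rw [hline]
    refine lt_of_pow_lt_pow_left₀ 2 (norm_nonneg _) ?_
    have hzero := hsquare 0
    rw [zero_smul, add_zero, zero_sub, neg_sq] at hzero
    rw [hzero]
    exact lt_add_of_pos_right _ (by positivity)
end

section
/- Let p, p', v be distinct points in ℝ^m with ‖v − p‖ ≤ ‖v − p'‖, and let p'' be the point of the segment [p', v] = {(1−γ)p' + γv : γ ∈ [0,1]} closest to p. Set δ = ‖p' − p‖, δ' = ‖p'' − p‖ and r = ‖v − p‖, and assume δ ≤ r. Then δ' ≤ δ √(1 − δ²/(4 r²)). -/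
/-- Per-iteration reduction of the Triangle Algorithm with a (non-strict) pivot.
Let `p, p', v` be distinct points with `‖v - p‖ ≤ ‖v - p'‖`, let `p''` be the point of the
segment `[p', v]` closest to `p`, and set `δ = ‖p' - p‖`, `δ' = ‖p'' - p‖`, `r = ‖v - p‖`.
If `δ ≤ r` then `δ' ≤ δ √(1 - δ²/(4r²))`. -/
theorem pivot_reduction {m : ℕ} (p p' v p'' : EuclideanSpace ℝ (Fin m))
    (hpp' : p ≠ p') (hpv : p ≠ v) (hp'v : p' ≠ v)
    (hpivot : ‖v - p‖ ≤ ‖v - p'‖)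
    (hmem : p'' ∈ segment ℝ p' v)
    (hclosest : ∀ y ∈ segment ℝ p' v, ‖p'' - p‖ ≤ ‖y - p‖)
    (δ δ' r : ℝ) (hδ : δ = ‖p' - p‖) (hδ' : δ' = ‖p'' - p‖) (hr : r = ‖v - p‖)
    (hδr : δ ≤ r) :
    δ' ≤ δ * Real.sqrt (1 - δ ^ 2 / (4 * r ^ 2)) := by
  have hr0 : 0 < r := by
    rw [hr]
    exact norm_pos_iff.mpr (sub_ne_zero.mpr hpv.symm)
  have hδ0 : 0 ≤ δ := hδ ▸ norm_nonneg _
  have hsq : δ ^ 2 ≤ r ^ 2 := pow_le_pow_left₀ hδ0 hδr 2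
  obtain ⟨γ, hγ⟩ : ∃ γ : ℝ, γ = δ ^ 2 / (2 * r ^ 2) := ⟨_, rfl⟩
  have hγ0 : 0 ≤ γ := by rw [hγ]; positivity
  have hγ1 : γ ≤ 1 := by
    rw [hγ, div_le_one (by positivity)]
    nlinarith
  have hy := hclosest ((1 - γ) • p' + γ • v)
    ⟨1 - γ, γ, sub_nonneg.mpr hγ1, hγ0, by ring, rfl⟩
  have hdecomp : (1 - γ) • p' + γ • v - p = (1 - γ) • (p' - p) + γ • (v - p) := by
    module
  have hinner : 2 * inner ℝ (p' - p) (v - p) ≤ δ ^ 2 := by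
    have h := norm_sub_sq_real (p' - p) (v - p)
    rw [sub_sub_sub_cancel_right, norm_sub_rev p' v, ← hδ, ← hr] at h
    have h' := pow_le_pow_left₀ (norm_nonneg _) hpivot 2
    rw [← hr] at h'
    linarith
  have hnorm : ‖(1 - γ) • p' + γ • v - p‖ ^ 2 ≤ δ ^ 2 * (1 - γ) + γ ^ 2 * r ^ 2 := by
    rw [hdecomp, norm_add_sq_real, norm_smul, norm_smul, inner_smul_left, inner_smul_right,
      mul_pow, mul_pow, ← hδ, ← hr, Real.norm_eq_abs, Real.norm_eq_abs, sq_abs, sq_abs]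
    simp only [conj_trivial]
    nlinarith [mul_le_mul_of_nonneg_left hinner (mul_nonneg hγ0 (sub_nonneg.mpr hγ1))]
  have hval : δ ^ 2 * (1 - γ) + γ ^ 2 * r ^ 2 = δ ^ 2 * (1 - δ ^ 2 / (4 * r ^ 2)) := by
    rw [hγ]
    field_simp
    ring
  have hsqrt : δ * Real.sqrt (1 - δ ^ 2 / (4 * r ^ 2)) =
      Real.sqrt (δ ^ 2 * (1 - δ ^ 2 / (4 * r ^ 2))) := by
    rw [Real.sqrt_mul (sq_nonneg δ), Real.sqrt_sq hδ0]
  rw [hsqrt, hδ']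
  refine Real.le_sqrt_of_sq_le ?_
  rw [← hval]
  exact (pow_le_pow_left₀ (norm_nonneg _) hy 2).trans hnorm
end

section
/- Let R > 0 and ε ∈ (0, 1), and let (δ_k)_{k≥0} be a sequence of nonnegative real numbers with δ₀ ≤ R satisfying δ_{k+1} ≤ δ_k √(1 − δ_k²/(4R²)) for every k ≥ 0. If K is a positive integer such that δ_k > εR for all k = 0, 1, …, K−1, then K ≤ 48/ε². In particular, there exists an index k ≤ 48/ε² with δ_k ≤ εR. (Iteration complexity of the Triangle Algorithm when p ∈ conv(𝒜).) -/
/-- A nonnegative sequence with `t (k + 1) ≤ t k * (1 - t k)` and `t 0 ≤ 1 / 4` decays like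
`1 / (k + 4)`. -/
theorem mul_add_four_le_one_of_logistic_step {t : ℕ → ℝ} (hnn : ∀ k, 0 ≤ t k)
    (h0 : t 0 ≤ 1 / 4) (hstep : ∀ k, t k ≤ 1 → t (k + 1) ≤ t k * (1 - t k)) (k : ℕ) :
    t k * (k + 4) ≤ 1 := by
  induction k with
  | zero => push_cast; linarith
  | succ k ih =>
    have hk : (0 : ℝ) ≤ k := k.cast_nonneg
    have ht1 : t k ≤ 1 := by nlinarith [hnn k, mul_nonneg (hnn k) hk]
    push_cast
    calc t (k + 1) * ((k : ℝ) + 1 + 4)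
        ≤ t k * (1 - t k) * ((k : ℝ) + 1 + 4) := by gcongr; exact hstep k ht1
      _ = (1 - t k) * (t k * (k + 4) + t k) := by ring
      _ ≤ (1 - t k) * (1 + t k) := by gcongr
      _ ≤ 1 := by nlinarith [sq_nonneg (t k)]

/-- Iteration complexity of the Triangle Algorithm when `p ∈ conv(𝒜)`. Let `R > 0`,
`ε ∈ (0,1)` and let `(δ_k)` be nonnegative with `δ₀ ≤ R` and
`δ_{k+1} ≤ δ_k √(1 - δ_k²/(4R²))` for all `k`. If `K` is a positive integer such that
`δ_k > εR` for all `k < K`, then `K ≤ 48/ε²`. In particular there is `k ≤ 48/ε²` with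
`δ_k ≤ εR`. -/
theorem triangle_complexity_inside (R ε : ℝ) (hR : 0 < R) (hε : ε ∈ Set.Ioo (0 : ℝ) 1)
    (δ : ℕ → ℝ) (hδnn : ∀ k, 0 ≤ δ k) (hδ0 : δ 0 ≤ R)
    (hrec : ∀ k, δ (k + 1) ≤ δ k * Real.sqrt (1 - (δ k) ^ 2 / (4 * R ^ 2))) :
    (∀ K : ℕ, 0 < K → (∀ k < K, ε * R < δ k) → (K : ℝ) ≤ 48 / ε ^ 2) ∧
    ∃ k : ℕ, (k : ℝ) ≤ 48 / ε ^ 2 ∧ δ k ≤ ε * R := by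
  obtain ⟨hε0, hε1⟩ := hε
  have hdecay := mul_add_four_le_one_of_logistic_step (t := fun k => δ k ^ 2 / (4 * R ^ 2))
    (fun k => by positivity)
    (by
      have := pow_le_pow_left₀ (hδnn 0) hδ0 2
      rw [div_le_iff₀ (by positivity)]
      linarith)
    (fun k hk => by
      have hsq := pow_le_pow_left₀ (hδnn (k + 1)) (hrec k) 2
      rw [mul_pow, Real.sq_sqrt (sub_nonneg.mpr hk)] at hsq
      calc δ (k + 1) ^ 2 / (4 * R ^ 2)
          ≤ δ k ^ 2 * (1 - δ k ^ 2 / (4 * R ^ 2)) / (4 * R ^ 2) := by gcongr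
        _ = δ k ^ 2 / (4 * R ^ 2) * (1 - δ k ^ 2 / (4 * R ^ 2)) := by ring)
  have hbound : ∀ K : ℕ, 0 < K → (∀ k < K, ε * R < δ k) → (K : ℝ) ≤ 48 / ε ^ 2 := by
    intro K hK hlt
    obtain ⟨m, rfl⟩ := Nat.exists_eq_succ_of_ne_zero hK.ne'
    have hlast : (ε * R) ^ 2 ≤ δ m ^ 2 :=
      pow_le_pow_left₀ (by positivity) (hlt m m.lt_succ_self).le 2
    have hε4 : ε ^ 2 / 4 * ((m : ℝ) + 4) ≤ 1 := by
      refine (mul_le_mul_of_nonneg_right ?_ (by positivity)).trans (hdecay m)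
      rw [le_div_iff₀ (by positivity)]
      linarith
    rw [le_div_iff₀ (by positivity)]
    push_cast
    nlinarith [sq_nonneg ε]
  refine ⟨hbound, ?_⟩
  by_contra! hne
  have hfloor := hbound (⌊48 / ε ^ 2⌋₊ + 1) (Nat.succ_pos _) fun k hk =>
    hne k ((Nat.le_floor_iff (by positivity)).mp (Nat.lt_succ_iff.mp hk))
  push_cast at hfloor
  exact (Nat.lt_floor_add_one (48 / ε ^ 2)).not_ge hfloor
end

section
/- Let 0 < Δ ≤ R and let (δ_k)_{k≥0} be a sequence of nonnegative real numbers with δ₀ ≤ R satisfying δ_{k+1} ≤ δ_k √(1 − δ_k²/(4R²)) for every k ≥ 0. If K is a positive integer such that δ_k ≥ Δ for all k = 0, 1, …, K−1, then K ≤ 48 R²/Δ². (Iteration complexity of the Triangle Algorithm to find a witness when p ∉ conv(𝒜), where Δ is the distance from p to conv(𝒜) and every iterate p_k ∈ conv(𝒜) satisfies ‖p_k − p‖ ≥ Δ.) -/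
/-- Squares of a sequence obeying the per-iteration decrease of the Triangle Algorithm
decay at least harmonically. -/
theorem add_four_mul_sq_le_of_le_mul_sqrt {R : ℝ} (hR : 0 < R) {δ : ℕ → ℝ}
    (hδnn : ∀ k, 0 ≤ δ k) (hδ0 : δ 0 ≤ R)
    (hrec : ∀ k, δ (k + 1) ≤ δ k * Real.sqrt (1 - (δ k) ^ 2 / (4 * R ^ 2))) (k : ℕ) :
    ((k : ℝ) + 4) * (δ k ^ 2 / (4 * R ^ 2)) ≤ 1 := by
  have hR2 : 0 < 4 * R ^ 2 := by positivity
  induction k with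
  | zero =>
    rw [← mul_div_assoc, div_le_one hR2]
    have := pow_le_pow_left₀ (hδnn 0) hδ0 2
    push_cast
    linarith
  | succ k ih =>
    have hsq := pow_le_pow_left₀ (hδnn (k + 1)) (hrec k) 2
    set t := δ k ^ 2 / (4 * R ^ 2) with ht
    have ht0 : 0 ≤ t := by positivity
    have hk : (0 : ℝ) ≤ k := k.cast_nonneg
    have ht1 : t ≤ 1 := by nlinarith
    rw [mul_pow, Real.sq_sqrt (by linarith)] at hsq
    have hstep : δ (k + 1) ^ 2 / (4 * R ^ 2) ≤ t * (1 - t) := by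
      rw [ht, div_mul_eq_mul_div, ← ht]
      gcongr
    calc ((k + 1 : ℕ) + 4 : ℝ) * (δ (k + 1) ^ 2 / (4 * R ^ 2))
        ≤ ((k + 1 : ℕ) + 4 : ℝ) * (t * (1 - t)) := by gcongr
      _ = 1 - ((1 - (k + 4) * t) * (1 - t) + t ^ 2) := by push_cast; ring
      _ ≤ 1 := by
        have := mul_nonneg (sub_nonneg.2 ih) (sub_nonneg.2 ht1)
        nlinarith [sq_nonneg t]

/-- Iteration complexity of the Triangle Algorithm to find a witness when `p ∉ conv(𝒜)`.
Let `0 < Δ ≤ R` and let `(δ_k)` be nonnegative with `δ₀ ≤ R` and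
`δ_{k+1} ≤ δ_k √(1 - δ_k²/(4R²))` for all `k`. If `K` is a positive integer such that
`δ_k ≥ Δ` for all `k < K`, then `K ≤ 48R²/Δ²`. -/
theorem triangle_complexity_outside (R Δ : ℝ) (hΔ : 0 < Δ) (hΔR : Δ ≤ R)
    (δ : ℕ → ℝ) (hδnn : ∀ k, 0 ≤ δ k) (hδ0 : δ 0 ≤ R)
    (hrec : ∀ k, δ (k + 1) ≤ δ k * Real.sqrt (1 - (δ k) ^ 2 / (4 * R ^ 2))) :
    ∀ K : ℕ, 0 < K → (∀ k < K, Δ ≤ δ k) → (K : ℝ) ≤ 48 * R ^ 2 / Δ ^ 2 := by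
  intro K hK hge
  have hR : 0 < R := hΔ.trans_le hΔR
  obtain ⟨n, rfl⟩ := Nat.exists_eq_succ_of_ne_zero hK.ne'
  have hdecay := add_four_mul_sq_le_of_le_mul_sqrt hR hδnn hδ0 hrec n
  rw [← mul_div_assoc, div_le_one (by positivity)] at hdecay
  have hsq := pow_le_pow_left₀ hΔ.le (hge n n.lt_succ_self) 2
  rw [le_div_iff₀ (by positivity)]
  calc ((n.succ : ℕ) : ℝ) * Δ ^ 2 ≤ ((n : ℝ) + 4) * δ n ^ 2 := by
        gcongr
        push_cast
        linarith
    _ ≤ 4 * R ^ 2 := hdecay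
    _ ≤ 48 * R ^ 2 := by nlinarith [sq_nonneg R]
end

section
/- Assume p ∉ 𝒜. Then p ∈ conv(𝒜) if and only if for every p' ∈ conv(𝒜) there exists v ∈ 𝒜 with (p' − p)ᵀ(v − p) ≤ 0, i.e. for every p' ∈ conv(𝒜) there exists a strict pivot v ∈ 𝒜. (Distance duality for strict pivots.) -/
open scoped RealInnerProductSpace

/-- Distance duality for strict pivots: if `p ∉ 𝒜` then `p ∈ conv(𝒜)` if and only if for
every `p' ∈ conv(𝒜)` there exists a strict pivot `v ∈ 𝒜`, i.e. `⟪p' - p, v - p⟫ ≤ 0`. -/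
theorem strict_pivot_duality {m : ℕ} (𝒜 : Finset (EuclideanSpace ℝ (Fin m))) (h𝒜 : 𝒜.Nonempty)
    (p : EuclideanSpace ℝ (Fin m)) (hp : p ∉ (𝒜 : Set (EuclideanSpace ℝ (Fin m)))) :
    p ∈ convexHull ℝ (𝒜 : Set (EuclideanSpace ℝ (Fin m))) ↔
      ∀ p' ∈ convexHull ℝ (𝒜 : Set (EuclideanSpace ℝ (Fin m))),
        ∃ v ∈ 𝒜, ⟪p' - p, v - p⟫ ≤ 0 := by
  constructor
  · intro hpc p' _
    by_contra! h
    have hconv : Convex ℝ {x | ⟪p' - p, p⟫ < ⟪p' - p, x⟫} :=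
      convex_halfSpace_gt (innerₗ _ (p' - p)).isLinear _
    have hsub : (𝒜 : Set (EuclideanSpace ℝ (Fin m))) ⊆ {x | ⟪p' - p, p⟫ < ⟪p' - p, x⟫} := by
      intro v hv
      have := h v hv
      rw [inner_sub_right] at this
      exact sub_pos.mp this
    exact lt_irrefl ⟪p' - p, p⟫ (convexHull_min hsub hconv hpc)
  · intro h
    have hK := convex_convexHull ℝ (𝒜 : Set (EuclideanSpace ℝ (Fin m)))
    obtain ⟨q, hq, hmin⟩ := exists_norm_eq_iInf_of_complete_convex
      (h𝒜.to_set.convexHull (𝕜 := ℝ))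
      (𝒜.finite_toSet.isCompact_convexHull ℝ).isComplete hK p
    obtain ⟨v, hv, hle⟩ := h q hq
    have hproj := (norm_eq_iInf_iff_real_inner_le_zero hK hq).mp hmin v
      (subset_convexHull ℝ _ hv)
    have hsplit : ⟪q - p, v - p⟫ = ⟪q - p, q - p⟫ - ⟪p - q, v - q⟫ := by
      rw [← neg_sub q p, inner_neg_left, sub_neg_eq_add, ← inner_add_right]
      congr 1
      abel
    have hzero : ⟪q - p, q - p⟫ ≤ 0 := by linarith
    rw [real_inner_self_nonpos, sub_eq_zero] at hzero
    exact hzero ▸ hq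
end

section
/- Let p, p', v ∈ ℝ^m with δ = ‖p' − p‖ > 0 and r = ‖v − p‖ > 0, and suppose v is a strict pivot at p', i.e. (p' − p)ᵀ(v − p) ≤ 0. Let p'' be the point of the segment [p', v] closest to p and δ' = ‖p'' − p‖. Then δ' ≤ δ r / √(r² + δ²); in particular δ' ≤ δ √(1 − δ²/(r² + δ²)). -/
open scoped RealInnerProductSpace

/-- If `x` and `w` make a non-acute angle, then the convex combination of `x` and `w` with weights
proportional to `‖w‖ ^ 2` and `‖x‖ ^ 2` has norm at most `‖x‖ ‖w‖ / √(‖w‖ ^ 2 + ‖x‖ ^ 2)`. -/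
theorem norm_weighted_combination_le_of_inner_nonpos {E : Type*} [NormedAddCommGroup E]
    [InnerProductSpace ℝ E] {x w : E} (hx : 0 < ‖x‖) (h : ⟪x, w⟫ ≤ 0) :
    ‖(‖w‖ ^ 2 / (‖w‖ ^ 2 + ‖x‖ ^ 2)) • x + (‖x‖ ^ 2 / (‖w‖ ^ 2 + ‖x‖ ^ 2)) • w‖ ≤
      ‖x‖ * ‖w‖ / Real.sqrt (‖w‖ ^ 2 + ‖x‖ ^ 2) := by
  have hS : 0 < ‖w‖ ^ 2 + ‖x‖ ^ 2 := by positivity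
  refine (sq_le_sq₀ (norm_nonneg _) (by positivity)).mp ?_
  rw [div_pow, Real.sq_sqrt hS.le, norm_add_sq_real, norm_smul, norm_smul, real_inner_smul_left,
    real_inner_smul_right, Real.norm_of_nonneg (by positivity), Real.norm_of_nonneg (by positivity)]
  have hcross : ‖w‖ ^ 2 / (‖w‖ ^ 2 + ‖x‖ ^ 2) * (‖x‖ ^ 2 / (‖w‖ ^ 2 + ‖x‖ ^ 2) * ⟪x, w⟫) ≤ 0 := by
    rw [← mul_assoc]
    exact mul_nonpos_of_nonneg_of_nonpos (by positivity) h
  have hsum : (‖w‖ ^ 2 / (‖w‖ ^ 2 + ‖x‖ ^ 2) * ‖x‖) ^ 2 +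
      (‖x‖ ^ 2 / (‖w‖ ^ 2 + ‖x‖ ^ 2) * ‖w‖) ^ 2 =
      (‖x‖ * ‖w‖) ^ 2 / (‖w‖ ^ 2 + ‖x‖ ^ 2) := by
    field_simp
  linarith

/-- Improved per-iteration reduction of the Triangle Algorithm with a strict pivot.
If `δ = ‖p' - p‖ > 0`, `r = ‖v - p‖ > 0`, `⟪p' - p, v - p⟫ ≤ 0` and `p''` is the point of
the segment `[p', v]` closest to `p`, with `δ' = ‖p'' - p‖`, then
`δ' ≤ δr/√(r² + δ²)`; in particular `δ' ≤ δ√(1 - δ²/(r² + δ²))`. -/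
theorem strict_pivot_reduction {m : ℕ} (p p' v p'' : EuclideanSpace ℝ (Fin m))
    (δ δ' r : ℝ) (hδ : δ = ‖p' - p‖) (hδpos : 0 < δ) (hr : r = ‖v - p‖) (hrpos : 0 < r)
    (hstrict : ⟪p' - p, v - p⟫ ≤ 0)
    (hmem : p'' ∈ segment ℝ p' v)
    (hclosest : ∀ y ∈ segment ℝ p' v, ‖p'' - p‖ ≤ ‖y - p‖)
    (hδ' : δ' = ‖p'' - p‖) :
    δ' ≤ δ * r / Real.sqrt (r ^ 2 + δ ^ 2) ∧
    δ' ≤ δ * Real.sqrt (1 - δ ^ 2 / (r ^ 2 + δ ^ 2)) := by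
  have hS : 0 < r ^ 2 + δ ^ 2 := by positivity
  have hbound : δ' ≤ δ * r / Real.sqrt (r ^ 2 + δ ^ 2) := by
    have hab : r ^ 2 / (r ^ 2 + δ ^ 2) + δ ^ 2 / (r ^ 2 + δ ^ 2) = 1 := by
      rw [← add_div, div_self hS.ne']
    have hy := hclosest ((r ^ 2 / (r ^ 2 + δ ^ 2)) • p' + (δ ^ 2 / (r ^ 2 + δ ^ 2)) • v)
      ⟨_, _, by positivity, by positivity, hab, rfl⟩
    have hsub : (r ^ 2 / (r ^ 2 + δ ^ 2)) • p' + (δ ^ 2 / (r ^ 2 + δ ^ 2)) • v - p =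
        (r ^ 2 / (r ^ 2 + δ ^ 2)) • (p' - p) + (δ ^ 2 / (r ^ 2 + δ ^ 2)) • (v - p) := by
      rw [smul_sub, smul_sub, sub_add_sub_comm, ← add_smul, hab, one_smul]
    have hle := norm_weighted_combination_le_of_inner_nonpos (hδ ▸ hδpos) hstrict
    rw [← hδ, ← hr, ← hsub] at hle
    exact hδ'.trans_le (hy.trans hle)
  have hsqrt : Real.sqrt (1 - δ ^ 2 / (r ^ 2 + δ ^ 2)) = r / Real.sqrt (r ^ 2 + δ ^ 2) := by
    rw [one_sub_div hS.ne', add_sub_cancel_right, Real.sqrt_div (sq_nonneg r),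
      Real.sqrt_sq hrpos.le]
  exact ⟨hbound, by rwa [hsqrt, ← mul_div_assoc]⟩
end

section
/- Let 𝒜 ⊂ ℝ^m be a nonempty finite set, p ∈ ℝ^m and ρ > 0 such that the closed Euclidean ball of radius ρ centered at p is contained in conv(𝒜). Let p' ∈ conv(𝒜) with p' ≠ p and set q = p + ρ (p − p')/‖p − p'‖. Then q ∈ conv(𝒜), there exists w ∈ 𝒜 with (p − q)ᵀ(w − q) ≤ 0, and any such w satisfies (p' − p)ᵀ(w − p) ≤ −ρ‖p' − p‖ < 0; in particular w is a strict pivot at p'. -/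
open scoped RealInnerProductSpace

/-- The functional `⟪v, ·⟫` takes on `s` a value at most its value at a given point of the convex
hull of `s`. -/
theorem exists_inner_sub_nonpos_of_mem_convexHull {E : Type*} [NormedAddCommGroup E]
    [InnerProductSpace ℝ E] {s : Set E} {x : E} (hx : x ∈ convexHull ℝ s) (v : E) :
    ∃ w ∈ s, ⟪v, w - x⟫ ≤ 0 := by
  by_contra! h
  have hsub : convexHull ℝ s ⊆ {w | ⟪v, x⟫ < ⟪v, w⟫} := by
    refine convexHull_min (fun w hw => ?_) (convex_halfSpace_gt (innerₛₗ ℝ v).isLinear _)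
    have hw' := h w hw
    rw [inner_sub_right] at hw'
    exact sub_pos.mp hw'
  exact lt_irrefl ⟪v, x⟫ (hsub hx)

/-- Existence of strong pivots when a ball around the query point lies in the convex hull.
If the closed ball `B̄_ρ(p) ⊆ conv(𝒜)` with `ρ > 0`, `p' ∈ conv(𝒜)`, `p' ≠ p` and
`q = p + ρ(p - p')/‖p - p'‖`, then `q ∈ conv(𝒜)`, there exists `w ∈ 𝒜` with
`⟪p - q, w - q⟫ ≤ 0`, and any such `w` satisfies `⟪p' - p, w - p⟫ ≤ -ρ‖p' - p‖ < 0`;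
in particular `w` is a strict pivot at `p'`. -/
theorem strong_pivot_exists {m : ℕ} (𝒜 : Finset (EuclideanSpace ℝ (Fin m))) (h𝒜 : 𝒜.Nonempty)
    (p p' q : EuclideanSpace ℝ (Fin m)) (ρ : ℝ) (hρ : 0 < ρ)
    (hball : Metric.closedBall p ρ ⊆ convexHull ℝ (𝒜 : Set (EuclideanSpace ℝ (Fin m))))
    (hp' : p' ∈ convexHull ℝ (𝒜 : Set (EuclideanSpace ℝ (Fin m)))) (hne : p' ≠ p)
    (hq : q = p + (ρ / ‖p - p'‖) • (p - p')) :
    q ∈ convexHull ℝ (𝒜 : Set (EuclideanSpace ℝ (Fin m))) ∧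
    (∃ w ∈ 𝒜, ⟪p - q, w - q⟫ ≤ 0) ∧
    ∀ w ∈ 𝒜, ⟪p - q, w - q⟫ ≤ 0 →
      ⟪p' - p, w - p⟫ ≤ -(ρ * ‖p' - p‖) ∧ -(ρ * ‖p' - p‖) < 0 := by
  have hnorm : 0 < ‖p - p'‖ := norm_pos_iff.mpr (sub_ne_zero.mpr hne.symm)
  have hqmem : q ∈ convexHull ℝ (𝒜 : Set (EuclideanSpace ℝ (Fin m))) := by
    apply hball
    rw [mem_closedBall_iff_norm, hq, add_sub_cancel_left, norm_smul,
      Real.norm_of_nonneg (by positivity), div_mul_cancel₀ _ hnorm.ne']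
  refine ⟨hqmem, by simpa using exists_inner_sub_nonpos_of_mem_convexHull hqmem (p - q), ?_⟩
  intro w _ hw
  rw [norm_sub_rev p' p]
  refine ⟨?_, neg_lt_zero.mpr (mul_pos hρ hnorm)⟩
  have hpq : p - q = -((ρ / ‖p - p'‖) • (p - p')) := by rw [hq]; abel
  have hwq : w - q = (w - p) - (ρ / ‖p - p'‖) • (p - p') := by rw [hq]; abel
  rw [hpq, hwq, inner_neg_left, real_inner_smul_left, inner_sub_right, real_inner_smul_right,
    real_inner_self_eq_norm_sq, neg_nonpos] at hw
  have hge := nonneg_of_mul_nonneg_right hw (div_pos hρ hnorm)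
  have hcancel : ρ / ‖p - p'‖ * ‖p - p'‖ ^ 2 = ρ * ‖p - p'‖ := by field_simp
  rw [← neg_sub p p', inner_neg_left]
  linarith
end

section
/- Let 𝒜 ⊂ ℝ^m be a nonempty finite set, p, p' ∈ ℝ^m with p' ≠ p, τ > 0 and q = p + τ (p − p'). Suppose there exists w ∈ 𝒜 with (p − q)ᵀ(w − q) ≤ 0, and let v_j ∈ 𝒜 be a minimizer of vᵀ(p' − p) over v ∈ 𝒜. Then (p − q)ᵀ(v_j − q) ≤ 0; that is, the greedy (Frank–Wolfe) choice of pivot also satisfies the strong pivot condition. -/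
open scoped RealInnerProductSpace

/-- The greedy (Frank–Wolfe) choice of pivot satisfies the strong pivot condition.
Let `p' ≠ p`, `τ > 0`, `q = p + τ(p - p')`. If some `w ∈ 𝒜` satisfies
`⟪p - q, w - q⟫ ≤ 0` and `v_j ∈ 𝒜` minimizes `v ↦ ⟪v, p' - p⟫` over `𝒜`, then
`⟪p - q, v_j - q⟫ ≤ 0`. -/
theorem greedy_pivot_is_strong {m : ℕ} (𝒜 : Finset (EuclideanSpace ℝ (Fin m)))
    (h𝒜 : 𝒜.Nonempty) (p p' q : EuclideanSpace ℝ (Fin m)) (hne : p' ≠ p)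
    (τ : ℝ) (hτ : 0 < τ) (hq : q = p + τ • (p - p'))
    (hex : ∃ w ∈ 𝒜, ⟪p - q, w - q⟫ ≤ 0)
    (vj : EuclideanSpace ℝ (Fin m)) (hvj : vj ∈ 𝒜)
    (hmin : ∀ v ∈ 𝒜, ⟪vj, p' - p⟫ ≤ ⟪v, p' - p⟫) :
    ⟪p - q, vj - q⟫ ≤ 0 := by
  obtain ⟨w, hw, hwq⟩ := hex
  have hpq : p - q = τ • (p' - p) := by rw [hq]; module
  rw [hpq, inner_sub_right, real_inner_smul_left, real_inner_comm] at hwq ⊢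
  have h := mul_le_mul_of_nonneg_left (hmin w hw) hτ.le
  linarith
end

section
/- Let p, q, v ∈ ℝ^m with ‖q − p‖ = ρ > 0 and ‖v − p‖ ≤ R. If (p − q)ᵀ(v − q) ≤ 0, then (q − p)ᵀ(v − p) ≥ ρ². Consequently ‖v − p‖ ≥ ρ, ρ R cos ∠qpv ≥ ρ² (so cos ∠qpv ≥ ρ/R), and sin ∠qpv ≤ √(1 − ρ²/R²) ≤ 1/√(1 + ρ²/R²). -/
open scoped RealInnerProductSpace

/-- Visibility-angle bound underlying linear convergence of the Triangle Algorithm with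
strong pivots. Let `‖q - p‖ = ρ > 0` and `‖v - p‖ ≤ R`. If `⟪p - q, v - q⟫ ≤ 0`, then
`⟪q - p, v - p⟫ ≥ ρ²`; consequently `‖v - p‖ ≥ ρ`, `ρR cos ∠qpv ≥ ρ²`
(so `cos ∠qpv ≥ ρ/R`), and `sin ∠qpv ≤ √(1 - ρ²/R²) ≤ 1/√(1 + ρ²/R²)`. -/
theorem strong_pivot_angle_bound {m : ℕ} (p q v : EuclideanSpace ℝ (Fin m)) (ρ R : ℝ)
    (hρ : 0 < ρ) (hq : ‖q - p‖ = ρ) (hvR : ‖v - p‖ ≤ R)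
    (hstrong : ⟪p - q, v - q⟫ ≤ 0) :
    ρ ^ 2 ≤ ⟪q - p, v - p⟫ ∧
    ρ ≤ ‖v - p‖ ∧
    ρ ^ 2 ≤ ρ * R * Real.cos (InnerProductGeometry.angle (q - p) (v - p)) ∧
    ρ / R ≤ Real.cos (InnerProductGeometry.angle (q - p) (v - p)) ∧
    Real.sin (InnerProductGeometry.angle (q - p) (v - p)) ≤ Real.sqrt (1 - ρ ^ 2 / R ^ 2) ∧
    Real.sqrt (1 - ρ ^ 2 / R ^ 2) ≤ 1 / Real.sqrt (1 + ρ ^ 2 / R ^ 2) := by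
  have hinner : ρ ^ 2 ≤ ⟪q - p, v - p⟫ := by
    have h : ⟪q - p, v - p⟫ = ρ ^ 2 - ⟪p - q, v - q⟫ := by
      rw [← sub_add_sub_cancel v q p, inner_add_right, real_inner_self_eq_norm_sq, hq,
        ← neg_sub p q, inner_neg_left]
      ring
    linarith
  have hnorm : ρ ≤ ‖v - p‖ := by
    have h := real_inner_le_norm (q - p) (v - p)
    rw [hq] at h
    nlinarith
  have hR : 0 < R := by linarith
  have hcos := InnerProductGeometry.cos_angle_mul_norm_mul_norm (q - p) (v - p)
  rw [hq] at hcos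
  set θ := InnerProductGeometry.angle (q - p) (v - p)
  have hcos_pos : 0 < Real.cos θ := by
    have h : 0 < Real.cos θ * (ρ * ‖v - p‖) := by rw [hcos]; nlinarith
    exact pos_of_mul_pos_left h (by positivity)
  have hmul : ρ ^ 2 ≤ ρ * R * Real.cos θ :=
    calc ρ ^ 2 ≤ Real.cos θ * (ρ * ‖v - p‖) := hinner.trans_eq hcos.symm
      _ ≤ Real.cos θ * (ρ * R) := by gcongr
      _ = ρ * R * Real.cos θ := by ring
  have hdiv : ρ / R ≤ Real.cos θ := by
    rw [div_le_iff₀ hR]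
    nlinarith
  refine ⟨hinner, hnorm, hmul, hdiv, ?_, ?_⟩
  · apply Real.le_sqrt_of_sq_le
    have h : (ρ / R) ^ 2 ≤ Real.cos θ ^ 2 := by gcongr
    rw [div_pow] at h
    linarith [Real.sin_sq_add_cos_sq θ]
  · have h : 0 ≤ ρ ^ 2 / R ^ 2 := by positivity
    rw [le_div_iff₀ (by positivity), ← Real.sqrt_mul' _ (by positivity), Real.sqrt_le_one]
    nlinarith
end

section
/- Let C = {x ∈ ℝ^m : aᵢᵀx ≤ bᵢ, i = 1, …, ℓ} be a nonempty compact polyhedron with every aᵢ ≠ 0, let V be its (finite) set of extreme points, and let c ∈ ℝ^m. Let U ⊆ V be nonempty, and let I_C(U) = {i ∈ {1,…,ℓ} : aᵢᵀu = bᵢ for all u ∈ U}. Suppose z ∈ ℝ^m satisfies aᵢᵀz ≤ 0 for all i ∈ I_C(U) and cᵀz > 0. Assume there is at least one pair (v, i) with v ∈ V and aᵢᵀv < bᵢ, and define Ω_C = min{(bᵢ − aᵢᵀv)/‖aᵢ‖ : v ∈ V, i ∈ {1,…,ℓ}, aᵢᵀv < bᵢ}. Then max{cᵀ(q − u) : q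 ∈ V, u ∈ U} ≥ (Ω_C/(m+1)) · (cᵀz)/‖z‖. -/
open scoped RealInnerProductSpace

/-- A continuous linear functional on a compact set is bounded by its values at the extreme
points. -/
theorem IsCompact.exists_mem_extremePoints_le {E : Type*} [AddCommGroup E] [Module ℝ E]
    [TopologicalSpace E] [T2Space E] [IsTopologicalAddGroup E] [ContinuousSMul ℝ E]
    [LocallyConvexSpace ℝ E] {C : Set E} (hC : IsCompact C) (f : E →L[ℝ] ℝ) {x : E} (hx : x ∈ C) :
    ∃ q ∈ C.extremePoints ℝ, f x ≤ f q := by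
  obtain ⟨y, hy, hmax⟩ := hC.exists_isMaxOn ⟨x, hx⟩ f.continuous.continuousOn
  have hF : IsExposed ℝ C (f.toExposed C) := ContinuousLinearMap.toExposed.isExposed
  obtain ⟨q, hq⟩ := (hF.isCompact hC).extremePoints_nonempty ⟨y, hy, fun p hp => hmax hp⟩
  exact ⟨q, hF.isExtreme.extremePoints_subset_extremePoints hq, hq.1.2 x hx⟩

/-- A nonempty subset of a finite-dimensional space contains at most `dim + 1` points with the same
affine span. -/
theorem exists_finset_subset_affineSpan_eq {E : Type*} [AddCommGroup E] [Module ℝ E]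
    [FiniteDimensional ℝ E] {U : Set E} (hU : U.Nonempty) :
    ∃ S : Finset E, ↑S ⊆ U ∧ S.Nonempty ∧ S.card ≤ Module.finrank ℝ E + 1 ∧
      affineSpan ℝ (S : Set E) = affineSpan ℝ U := by
  obtain ⟨T, hTU, hspan, hind⟩ := exists_affineIndependent ℝ E U
  have hfin : T.Finite := finite_set_of_fin_dim_affineIndependent ℝ hind
  lift T to Finset E using hfin
  refine ⟨T, hTU, ?_, ?_, hspan⟩
  · rw [← Finset.coe_nonempty, ← affineSpan_nonempty ℝ, hspan, affineSpan_nonempty]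
    exact hU
  · have h := hind.card_le_finrank_succ
    simp only [SetLike.coe_sort_coe, Fintype.card_coe] at h
    exact h.trans (Nat.succ_le_succ (Submodule.finrank_le _))

/-- A linear functional that is constant on a set is constant on its affine span. -/
theorem LinearMap.eq_of_mem_affineSpan {E : Type*} [AddCommGroup E] [Module ℝ E] (f : E →ₗ[ℝ] ℝ)
    {S : Set E} {r : ℝ} (hS : ∀ s ∈ S, f s = r) {x : E} (hx : x ∈ affineSpan ℝ S) : f x = r := by
  refine affineSpan_induction (p := fun x => f x = r) hx hS fun t u v w hu hv hw => ?_
  simp [hu, hv, hw]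

/-- Geometric lemma of Beck and Shtern used in the linear convergence analysis of the
Away-Step Frank–Wolfe algorithm. Let `C = {x : ⟪a i, x⟫ ≤ b i}` be a nonempty compact
polyhedron in `ℝ^m` with `a i ≠ 0`, `V` its set of extreme points, `U ⊆ V` nonempty, and
`I_C(U)` the active index set on `U`. If `z` satisfies `⟪a i, z⟫ ≤ 0` for all
`i ∈ I_C(U)` and `⟪c, z⟫ > 0`, and `Ω_C` is the minimum of `(b i - ⟪a i, v⟫)/‖a i‖` over
pairs with `v ∈ V` and `⟪a i, v⟫ < b i`, then
`max {⟪c, q - u⟫ : q ∈ V, u ∈ U} ≥ (Ω_C/(m + 1)) ⟪c, z⟫/‖z‖`. -/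
theorem beck_shtern_lemma {m ℓ : ℕ} (a : Fin ℓ → EuclideanSpace ℝ (Fin m)) (b : Fin ℓ → ℝ)
    (ha : ∀ i, a i ≠ 0)
    (C : Set (EuclideanSpace ℝ (Fin m))) (hCdef : C = {x | ∀ i, ⟪a i, x⟫ ≤ b i})
    (hCne : C.Nonempty) (hCcomp : IsCompact C)
    (V : Set (EuclideanSpace ℝ (Fin m))) (hV : V = C.extremePoints ℝ)
    (U : Set (EuclideanSpace ℝ (Fin m))) (hUV : U ⊆ V) (hUne : U.Nonempty)
    (c z : EuclideanSpace ℝ (Fin m))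
    (hz : ∀ i : Fin ℓ, (∀ u ∈ U, ⟪a i, u⟫ = b i) → ⟪a i, z⟫ ≤ 0)
    (hcz : 0 < ⟪c, z⟫)
    (Ω : ℝ)
    (hΩ : IsLeast {r : ℝ | ∃ v ∈ V, ∃ i : Fin ℓ, ⟪a i, v⟫ < b i ∧
      r = (b i - ⟪a i, v⟫) / ‖a i‖} Ω) :
    ∃ q ∈ V, ∃ u ∈ U, Ω / (m + 1) * (⟪c, z⟫ / ‖z‖) ≤ ⟪c, q - u⟫ := by
  subst hCdef hV
  have hzpos : 0 < ‖z‖ := norm_pos_iff.2 fun h => by simp [h] at hcz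
  obtain ⟨S, hSU, hSne, hcard, hspan⟩ := exists_finset_subset_affineSpan_eq hUne
  rw [finrank_euclideanSpace_fin] at hcard
  have hΩpos : 0 < Ω := by
    obtain ⟨v, -, i, hi, rfl⟩ := hΩ.1
    exact div_pos (sub_pos.2 hi) (norm_pos_iff.2 (ha i))
  have hn : (0 : ℝ) < S.card := Nat.cast_pos.2 hSne.card_pos
  have hfeas : ∀ s ∈ S, ∀ i, ⟪a i, s⟫ ≤ b i := fun s hs => (hUV (hSU hs)).1
  obtain ⟨w, hinner⟩ : ∃ w : EuclideanSpace ℝ (Fin m),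
      ∀ y, S.card * ⟪y, w⟫ = ∑ s ∈ S, ⟪y, s⟫ :=
    ⟨(S.card : ℝ)⁻¹ • ∑ s ∈ S, s, fun y => by
      rw [inner_smul_right, inner_sum, mul_inv_cancel_left₀ hn.ne']⟩
  set t : ℝ := Ω / S.card / ‖z‖ with ht
  have htpos : 0 < t := by positivity
  have hx : w + t • z ∈ {x | ∀ i, ⟪a i, x⟫ ≤ b i} := fun i => by
    rw [inner_add_right, inner_smul_right]
    by_cases hact : ∀ s ∈ S, ⟪a i, s⟫ = b i
    · have hzi : ⟪a i, z⟫ ≤ 0 := hz i fun u hu =>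
        (innerₛₗ ℝ (a i)).eq_of_mem_affineSpan hact (hspan ▸ subset_affineSpan ℝ U hu)
      have hwi := hinner (a i)
      rw [Finset.sum_congr rfl hact, Finset.sum_const, nsmul_eq_mul] at hwi
      have hwi := mul_left_cancel₀ hn.ne' hwi
      nlinarith
    · push Not at hact
      obtain ⟨s, hs, hsi⟩ := hact
      have hlt := (hfeas s hs i).lt_of_ne hsi
      have hslack : Ω * ‖a i‖ ≤ b i - ⟪a i, s⟫ := by
        rw [← le_div_iff₀ (norm_pos_iff.2 (ha i))]
        exact hΩ.2 ⟨s, hUV (hSU hs), i, hlt, rfl⟩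
      have hsum : b i - ⟪a i, s⟫ ≤ S.card * (b i - ⟪a i, w⟫) := by
        rw [mul_sub, hinner, ← nsmul_eq_mul, ← Finset.sum_const, ← Finset.sum_sub_distrib]
        exact Finset.single_le_sum (f := fun s => b i - ⟪a i, s⟫)
          (fun s hs => sub_nonneg.2 (hfeas s hs i)) hs
      have hstep : t * ⟪a i, z⟫ ≤ Ω * ‖a i‖ / S.card :=
        calc t * ⟪a i, z⟫ ≤ t * (‖a i‖ * ‖z‖) := by
              gcongr
              exact real_inner_le_norm _ _
          _ = Ω * ‖a i‖ / S.card := by rw [ht]; field_simp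
      have hwslack : Ω * ‖a i‖ / S.card ≤ b i - ⟪a i, w⟫ := by
        rw [div_le_iff₀' hn]
        exact hslack.trans hsum
      linarith
  obtain ⟨q, hq, hqx⟩ := hCcomp.exists_mem_extremePoints_le (innerSL ℝ c) hx
  obtain ⟨u, hu, huw⟩ : ∃ u ∈ S, ⟪c, u⟫ ≤ ⟪c, w⟫ := by
    refine Finset.exists_le_of_sum_le hSne ?_
    rw [← hinner, Finset.sum_const, nsmul_eq_mul]
  refine ⟨q, hq, u, hSU hu, ?_⟩
  simp only [innerSL_apply_apply, inner_add_right, inner_smul_right] at hqx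
  have hcoef : Ω / (m + 1) * (⟪c, z⟫ / ‖z‖) ≤ t * ⟪c, z⟫ :=
    calc Ω / (m + 1) * (⟪c, z⟫ / ‖z‖) ≤ Ω / S.card * (⟪c, z⟫ / ‖z‖) := by
          gcongr
          exact_mod_cast hcard
      _ = t * ⟪c, z⟫ := by rw [ht]; ring
  rw [inner_sub_right]
  linarith
end

section
/- Let f : ℝ^m → ℝ be differentiable, μ-strongly convex (μ > 0), with L-Lipschitz gradient (L > 0). Let C ⊆ ℝ^m be convex, x* a minimizer of f over C, and x ∈ C with x ≠ x*. Let d ∈ ℝ^m with ∇f(x)ᵀd < 0, set γ* = −∇f(x)ᵀd/(L‖d‖²) and x⁺ = x + γ* d. Write d̂ = d/‖d‖ and ê = (x* − x)/‖x* − x‖. Then ∇f(x)ᵀê < 0, and f(x⁺) − f(x*) ≤ [1 − (μ/L) · ((∇f(x)ᵀd̂)/(∇f(x)ᵀê))²] · (f(x) − f(x*)). (Key per-iteration contraction inequality behind linear convergence of Frank–Wolfe-type methods.) -/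
open scoped RealInnerProductSpace

/-- The descent lemma: a differentiable function with `L`-Lipschitz gradient lies below the
quadratic upper model at each point. -/
theorem descent_lemma_of_lipschitz_gradient {E : Type*} [NormedAddCommGroup E]
    [InnerProductSpace ℝ E] [CompleteSpace E] {f : E → ℝ} {L : ℝ}
    (hdiff : Differentiable ℝ f)
    (hlip : ∀ x y : E, ‖gradient f x - gradient f y‖ ≤ L * ‖x - y‖) (x v : E) :
    f (x + v) ≤ f x + ⟪gradient f x, v⟫ + L / 2 * ‖v‖ ^ 2 := by
  have hderiv (t : ℝ) : HasDerivAt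
      (fun t : ℝ => f (x + t • v) - t * ⟪gradient f x, v⟫ - t ^ 2 * (L / 2 * ‖v‖ ^ 2))
      (⟪gradient f (x + t • v), v⟫ - ⟪gradient f x, v⟫ - L * t * ‖v‖ ^ 2) t := by
    have hline : HasDerivAt (fun t : ℝ => x + t • v) v t := by
      simpa using ((hasDerivAt_id t).smul_const v).const_add x
    have hf : HasDerivAt (fun t : ℝ => f (x + t • v)) ⟪gradient f (x + t • v), v⟫ t := by
      have h := (hdiff (x + t • v)).hasGradientAt.hasFDerivAt.comp_hasDerivAt t hline
      rwa [InnerProductSpace.toDual_apply_apply] at h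
    have hlin := (hasDerivAt_id t).mul_const ⟪gradient f x, v⟫
    have hquad := (hasDerivAt_pow 2 t).mul_const (L / 2 * ‖v‖ ^ 2)
    refine ((hf.sub hlin).sub hquad).congr_deriv ?_
    push_cast
    ring
  have hanti := antitoneOn_of_deriv_nonpos (convex_Icc (0 : ℝ) 1)
    (fun t _ => (hderiv t).continuousAt.continuousWithinAt)
    (fun t _ => (hderiv t).differentiableAt.differentiableWithinAt)
    (fun t ht => by
      rw [interior_Icc] at ht
      rw [(hderiv t).deriv, ← inner_sub_left]
      have hnorm : ‖gradient f (x + t • v) - gradient f x‖ ≤ L * (t * ‖v‖) := by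
        simpa [norm_smul, abs_of_pos ht.1] using hlip (x + t • v) x
      have hinner := real_inner_le_norm (gradient f (x + t • v) - gradient f x) v
      nlinarith [mul_le_mul_of_nonneg_right hnorm (norm_nonneg v)])
  have h := hanti (Set.left_mem_Icc.2 zero_le_one) (Set.right_mem_Icc.2 zero_le_one) zero_le_one
  simp only [one_smul, zero_smul, add_zero] at h
  linarith

/-- Key per-iteration contraction inequality behind linear convergence of
Frank–Wolfe-type methods. Let `f` be differentiable, `μ`-strongly convex with
`L`-Lipschitz gradient, `C` convex, `x*` a minimizer of `f` over `C`, `x ∈ C`, `x ≠ x*`,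
and `d` a descent direction (`⟪∇f(x), d⟫ < 0`). With `γ* = -⟪∇f(x), d⟫/(L‖d‖²)`,
`x⁺ = x + γ*d`, `d̂ = d/‖d‖` and `ê = (x* - x)/‖x* - x‖`, one has `⟪∇f(x), ê⟫ < 0` and
`f(x⁺) - f(x*) ≤ (1 - (μ/L)(⟪∇f(x), d̂⟫/⟪∇f(x), ê⟫)²)(f(x) - f(x*))`. -/
theorem fw_contraction {n : ℕ} (f : EuclideanSpace ℝ (Fin n) → ℝ) (μ L : ℝ)
    (hμ : 0 < μ) (hL : 0 < L)
    (hdiff : Differentiable ℝ f)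
    (hsc : ∀ x y : EuclideanSpace ℝ (Fin n),
      f x + ⟪gradient f x, y - x⟫ + μ / 2 * ‖y - x‖ ^ 2 ≤ f y)
    (hlip : ∀ x y : EuclideanSpace ℝ (Fin n), ‖gradient f x - gradient f y‖ ≤ L * ‖x - y‖)
    (C : Set (EuclideanSpace ℝ (Fin n))) (hC : Convex ℝ C)
    (xstar : EuclideanSpace ℝ (Fin n)) (hxstar : xstar ∈ C)
    (hmin : ∀ y ∈ C, f xstar ≤ f y)
    (x : EuclideanSpace ℝ (Fin n)) (hx : x ∈ C) (hne : x ≠ xstar)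
    (d : EuclideanSpace ℝ (Fin n)) (hd : ⟪gradient f x, d⟫ < 0)
    (γstar : ℝ) (hγstar : γstar = -⟪gradient f x, d⟫ / (L * ‖d‖ ^ 2))
    (xplus dhat ehat : EuclideanSpace ℝ (Fin n))
    (hxplus : xplus = x + γstar • d)
    (hdhat : dhat = ‖d‖⁻¹ • d)
    (hehat : ehat = ‖xstar - x‖⁻¹ • (xstar - x)) :
    ⟪gradient f x, ehat⟫ < 0 ∧
    f xplus - f xstar ≤
      (1 - μ / L * (⟪gradient f x, dhat⟫ / ⟪gradient f x, ehat⟫) ^ 2) *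
        (f x - f xstar) := by
  have hr : 0 < ‖xstar - x‖ := norm_pos_iff.2 (sub_ne_zero.2 hne.symm)
  have hd0 : 0 < ‖d‖ := norm_pos_iff.2 fun h => by simp [h] at hd
  have hstrong := hsc x xstar
  have hdescent : ⟪gradient f x, xstar - x⟫ < 0 := by
    have : 0 < μ / 2 * ‖xstar - x‖ ^ 2 := by positivity
    linarith [hmin x hx]
  have hehat_neg : ⟪gradient f x, ehat⟫ < 0 := by
    rw [hehat, real_inner_smul_right]
    exact mul_neg_of_pos_of_neg (inv_pos.2 hr) hdescent
  refine ⟨hehat_neg, ?_⟩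
  have hinner : ⟪gradient f x, xstar - x⟫ = ‖xstar - x‖ * ⟪gradient f x, ehat⟫ := by
    rw [hehat, real_inner_smul_right, mul_inv_cancel_left₀ hr.ne']
  have hgap : f x - f xstar ≤ ⟪gradient f x, ehat⟫ ^ 2 / (2 * μ) := by
    rw [le_div_iff₀ (by positivity)]
    rw [hinner] at hstrong
    nlinarith [sq_nonneg (⟪gradient f x, ehat⟫ + μ * ‖xstar - x‖)]
  have hdecrease : f xplus ≤ f x - ⟪gradient f x, dhat⟫ ^ 2 / (2 * L) := by
    have h := descent_lemma_of_lipschitz_gradient hdiff hlip x (γstar • d)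
    rw [← hxplus, real_inner_smul_right, norm_smul, mul_pow, Real.norm_eq_abs, sq_abs,
      hγstar] at h
    refine h.trans_eq ?_
    rw [hdhat, real_inner_smul_right]
    field_simp
    ring
  have hprogress : μ / L * (⟪gradient f x, dhat⟫ / ⟪gradient f x, ehat⟫) ^ 2 *
      (f x - f xstar) ≤ ⟪gradient f x, dhat⟫ ^ 2 / (2 * L) := by
    refine (mul_le_mul_of_nonneg_left hgap (by positivity)).trans_eq ?_
    have := hehat_neg.ne
    field_simp
  linarith
end

section
/- Let f : ℝⁿ → ℝ be a continuously differentiable convex function with L-Lipschitz gradient and let C ⊂ ℝⁿ be a nonempty, convex and compact set with diameter D = max{‖x − y‖ : x, y ∈ C}. If x* ∈ C is a minimizer of f over C and x̄ = P_C(x − λ∇f(x)) for some λ > 0 and x ∈ C, where P_C denotes the Euclidean orthogonal projection onto C, then f(x̄) − f(x*) ≤ D (L/2 + 1/λ) ‖x̄ − x‖. -/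
section

variable {F : Type*} [NormedAddCommGroup F] [InnerProductSpace ℝ F]

/-- The variational inequality characterizing a nearest point of a convex set. -/
theorem Convex.inner_sub_sub_nonpos_of_norm_sub_le {C : Set F} (hC : Convex ℝ C) {u v : F}
    (hv : v ∈ C) (hmin : ∀ w ∈ C, ‖u - v‖ ≤ ‖u - w‖) {w : F} (hw : w ∈ C) :
    inner ℝ (u - v) (w - v) ≤ 0 := by
  have : Nonempty C := ⟨⟨v, hv⟩⟩
  refine (norm_eq_iInf_iff_real_inner_le_zero hC hv).1 (le_antisymm ?_ ?_) w hw
  · exact le_ciInf fun w => hmin w w.2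
  · exact ciInf_le (f := fun w : C => ‖u - w‖)
      ⟨0, Set.forall_mem_range.2 fun w => norm_nonneg _⟩ ⟨v, hv⟩

variable [CompleteSpace F] {f : F → ℝ}

theorem HasGradientAt.hasDerivAt_comp_lineMap {x y f' : F} {t : ℝ}
    (hf : HasGradientAt f f' (AffineMap.lineMap x y t)) :
    HasDerivAt (fun s : ℝ => f (AffineMap.lineMap x y s)) (inner ℝ f' (y - x)) t := by
  simpa [Function.comp_def] using hf.hasFDerivAt.comp_hasDerivAt t AffineMap.hasDerivAt_lineMap

/-- The first-order lower bound for a convex function. -/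
theorem ConvexOn.add_inner_gradient_le (hconv : ConvexOn ℝ Set.univ f) {x : F}
    (hf : DifferentiableAt ℝ f x) (y : F) :
    f x + inner ℝ (gradient f x) (y - x) ≤ f y := by
  have hderiv : HasDerivAt (fun s : ℝ => f (AffineMap.lineMap x y s))
      (inner ℝ (gradient f x) (y - x)) 0 :=
    HasGradientAt.hasDerivAt_comp_lineMap (by simpa using hf.hasGradientAt)
  have hslope := (hconv.comp_affineMap (AffineMap.lineMap x y)).le_slope_of_hasDerivAt
    (Set.mem_univ 0) (Set.mem_univ 1) one_pos hderiv
  simp only [slope_def_field, Function.comp_apply, AffineMap.lineMap_apply_one,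
    AffineMap.lineMap_apply_zero, sub_zero, div_one] at hslope
  linarith

/-- The descent lemma: the quadratic upper bound for a function with Lipschitz gradient. -/
theorem le_add_inner_gradient_add_sq_of_lipschitz_gradient (hf : Differentiable ℝ f) {L : ℝ}
    (hlip : ∀ x y, ‖gradient f x - gradient f y‖ ≤ L * ‖x - y‖) (x y : F) :
    f y ≤ f x + inner ℝ (gradient f x) (y - x) + L / 2 * ‖y - x‖ ^ 2 := by
  have hderiv (t : ℝ) : HasDerivAt
      (fun s : ℝ => f (AffineMap.lineMap x y s) - s * inner ℝ (gradient f x) (y - x)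
        - s ^ 2 * (L / 2 * ‖y - x‖ ^ 2))
      (inner ℝ (gradient f (AffineMap.lineMap x y t) - gradient f x) (y - x)
        - t * (L * ‖y - x‖ ^ 2)) t := by
    refine (((hf _).hasGradientAt.hasDerivAt_comp_lineMap.sub
      ((hasDerivAt_id t).mul_const (inner ℝ (gradient f x) (y - x)))).sub
      ((hasDerivAt_pow 2 t).mul_const (L / 2 * ‖y - x‖ ^ 2))).congr_deriv ?_
    rw [inner_sub_left]
    push_cast
    ring
  have hanti := antitoneOn_of_hasDerivWithinAt_nonpos (convex_Icc (0 : ℝ) 1)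
    (fun t _ => (hderiv t).continuousAt.continuousWithinAt)
    (fun t _ => (hderiv t).hasDerivWithinAt) fun t ht => by
      have ht0 : 0 ≤ t := (interior_subset ht).1
      have hdist : ‖(AffineMap.lineMap x y t : F) - x‖ = t * ‖y - x‖ := by
        rw [AffineMap.lineMap_apply, vsub_eq_sub, vadd_eq_add, add_sub_cancel_right,
          norm_smul, Real.norm_of_nonneg ht0]
      rw [sub_nonpos]
      calc inner ℝ (gradient f (AffineMap.lineMap x y t) - gradient f x) (y - x)
          ≤ ‖gradient f (AffineMap.lineMap x y t) - gradient f x‖ * ‖y - x‖ :=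
            real_inner_le_norm _ _
        _ ≤ L * ‖(AffineMap.lineMap x y t : F) - x‖ * ‖y - x‖ := by gcongr; exact hlip _ _
        _ = t * (L * ‖y - x‖ ^ 2) := by rw [hdist]; ring
  have h01 := hanti (Set.left_mem_Icc.2 zero_le_one) (Set.right_mem_Icc.2 zero_le_one) zero_le_one
  simp only [AffineMap.lineMap_apply_one, AffineMap.lineMap_apply_zero] at h01
  linarith

end


/-- Lemma justifying the specialized stopping criterion of the Spectral Projected
Gradient method. Let `f` be a differentiable convex function with `L`-Lipschitz gradient
and `C` a nonempty convex compact set of diameter `D`. If `x*` minimizes `f` over `C` and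
`x̄ = P_C(x - λ∇f(x))` for some `λ > 0` and `x ∈ C`, then
`f(x̄) - f(x*) ≤ D(L/2 + 1/λ)‖x̄ - x‖`. -/
theorem spg_stopping_lemma {n : ℕ} (f : EuclideanSpace ℝ (Fin n) → ℝ) (L : ℝ)
    (hdiff : Differentiable ℝ f)
    (hconv : ConvexOn ℝ Set.univ f)
    (hlip : ∀ x y : EuclideanSpace ℝ (Fin n), ‖gradient f x - gradient f y‖ ≤ L * ‖x - y‖)
    (C : Set (EuclideanSpace ℝ (Fin n))) (hCne : C.Nonempty) (hCconv : Convex ℝ C)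
    (hCcomp : IsCompact C)
    (D : ℝ) (hD : D = Metric.diam C)
    (xstar : EuclideanSpace ℝ (Fin n)) (hxstar : xstar ∈ C)
    (hmin : ∀ y ∈ C, f xstar ≤ f y)
    (x : EuclideanSpace ℝ (Fin n)) (hx : x ∈ C) (lam : ℝ) (hlam : 0 < lam)
    (xbar : EuclideanSpace ℝ (Fin n)) (hxbarC : xbar ∈ C)
    (hproj : ∀ w ∈ C, ‖x - lam • gradient f x - xbar‖ ≤ ‖x - lam • gradient f x - w‖) :
    f xbar - f xstar ≤ D * (L / 2 + 1 / lam) * ‖xbar - x‖ := by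
  have hdescent := le_add_inner_gradient_add_sq_of_lipschitz_gradient hdiff hlip x xbar
  have hlower := hconv.add_inner_gradient_le (hdiff x) xstar
  have hvar := hCconv.inner_sub_sub_nonpos_of_norm_sub_le hxbarC hproj hxstar
  have hdiam {u v : EuclideanSpace ℝ (Fin n)} (hu : u ∈ C) (hv : v ∈ C) : ‖u - v‖ ≤ D := by
    rw [hD, ← dist_eq_norm]
    exact Metric.dist_le_diam_of_mem hCcomp.isBounded hu hv
  have hinner : lam * inner ℝ (gradient f x) (xbar - xstar) ≤ D * ‖xbar - x‖ :=
    calc lam * inner ℝ (gradient f x) (xbar - xstar)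
        ≤ inner ℝ (xbar - x) (xstar - xbar) := by
          simp only [inner_sub_left, inner_sub_right, real_inner_smul_left] at hvar ⊢
          linarith
      _ ≤ ‖xbar - x‖ * ‖xstar - xbar‖ := real_inner_le_norm _ _
      _ ≤ ‖xbar - x‖ * D := by gcongr; exact hdiam hxstar hxbarC
      _ = D * ‖xbar - x‖ := mul_comm _ _
  have hgrad : inner ℝ (gradient f x) (xbar - xstar) ≤ D * ‖xbar - x‖ / lam := by
    rwa [le_div_iff₀' hlam]
  have hquad : L * ‖xbar - x‖ * ‖xbar - x‖ ≤ L * ‖xbar - x‖ * D :=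
    mul_le_mul_of_nonneg_left (hdiam hxbarC hx) ((norm_nonneg _).trans (hlip xbar x))
  calc f xbar - f xstar
      ≤ inner ℝ (gradient f x) (xbar - xstar) + L * ‖xbar - x‖ * ‖xbar - x‖ / 2 := by
        simp only [inner_sub_right] at hdescent hlower ⊢
        linarith
    _ ≤ D * ‖xbar - x‖ / lam + L * ‖xbar - x‖ * D / 2 := by gcongr
    _ = D * (L / 2 + 1 / lam) * ‖xbar - x‖ := by ring
end

section
/- Let A ∈ ℝ^{m×n} with columns a₁, …, aₙ ∈ ℝ^m, b ∈ ℝ^m and N > 0. Define the set à ⊂ ℝ^{m+2} consisting of the n + 2 points (aⱼ, 1, 0) for j = 1, …, n, the point (0, 1, 0), and the point (−b, −N, 1), and let p = (0, 0, 1/(N+1)) ∈ ℝ^{m+2}. Then the set Ω ∩ H_N = {x ∈ ℝⁿ : Ax = b, x ≥ 0, eᵀx ≤ N} is nonempty if and only if p ∈ conv(Ã). (Reduction of the bounded linear-programming feasibility problem to a convex hull membership problem.) -/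
/-- The convex hull of a finite family consists of its convex combinations. -/
theorem mem_convexHull_range_iff_exists_weights {ι E : Type*} [Fintype ι] [AddCommGroup E]
    [Module ℝ E] {f : ι → E} {y : E} :
    y ∈ convexHull ℝ (Set.range f) ↔
      ∃ w : ι → ℝ, (∀ i, 0 ≤ w i) ∧ ∑ i, w i = 1 ∧ ∑ i, w i • f i = y := by
  classical
  have h : Set.range f =
      Fintype.linearCombination ℝ f '' Set.range fun i : ι ↦ Pi.single i (1 : ℝ) := by
    rw [← Set.range_comp]
    congr 1
    ext i
    simp [Fintype.linearCombination_apply_single]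
  rw [h, ← LinearMap.image_convexHull, convexHull_rangle_single_eq_stdSimplex]
  simp [stdSimplex, Fintype.linearCombination_apply, and_assoc]

/-- Reduction of the bounded linear-programming feasibility problem to a convex hull
membership problem. Given columns `a₁, …, aₙ ∈ ℝ^m`, `b ∈ ℝ^m` and `N > 0`, the set
`{x ∈ ℝⁿ : Ax = b, x ≥ 0, eᵀx ≤ N}` is nonempty if and only if the point
`p = (0, 0, 1/(N+1)) ∈ ℝ^{m+2}` belongs to the convex hull of the `n + 2` points
`(aⱼ, 1, 0)`, `(0, 1, 0)` and `(-b, -N, 1)`. -/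
theorem lp_feasibility_as_chmp {m n : ℕ} (a : Fin n → EuclideanSpace ℝ (Fin m))
    (b : EuclideanSpace ℝ (Fin m)) (N : ℝ) (hN : 0 < N) :
    (∃ x : Fin n → ℝ, (∀ j, 0 ≤ x j) ∧ (∑ j, x j • a j) = b ∧ (∑ j, x j) ≤ N) ↔
      ((0 : EuclideanSpace ℝ (Fin m)), (0 : ℝ), 1 / (N + 1)) ∈
        convexHull ℝ
          ((Set.range fun j : Fin n => (a j, (1 : ℝ), (0 : ℝ))) ∪
            {((0 : EuclideanSpace ℝ (Fin m)), (1 : ℝ), (0 : ℝ))} ∪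
            {(-b, -N, (1 : ℝ))}) := by
  have hN1 : 0 < N + 1 := by linarith
  have hrange : (Set.range fun j : Fin n => (a j, (1 : ℝ), (0 : ℝ))) ∪
      {((0 : EuclideanSpace ℝ (Fin m)), (1 : ℝ), (0 : ℝ))} ∪ {(-b, -N, (1 : ℝ))} =
      Set.range (Sum.elim (Sum.elim (fun j : Fin n => (a j, (1 : ℝ), (0 : ℝ)))
        fun _ : Unit => ((0 : EuclideanSpace ℝ (Fin m)), (1 : ℝ), (0 : ℝ)))
        fun _ : Unit => (-b, -N, (1 : ℝ))) := by
    simp [Set.Sum.elim_range]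
  rw [hrange, mem_convexHull_range_iff_exists_weights]
  constructor
  · rintro ⟨x, hx, hxb, hxN⟩
    refine ⟨Sum.elim (Sum.elim (fun j => (N + 1)⁻¹ * x j)
      fun _ => (N + 1)⁻¹ * (N - ∑ j, x j)) fun _ => (N + 1)⁻¹, ?_, ?_, ?_⟩
    · rintro ((j | _) | _)
      · exact mul_nonneg (inv_nonneg.2 hN1.le) (hx j)
      · exact mul_nonneg (inv_nonneg.2 hN1.le) (sub_nonneg.2 hxN)
      · exact inv_nonneg.2 hN1.le
    · simp only [Fintype.sum_sum_type, Sum.elim_inl, Sum.elim_inr, Finset.univ_unique,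
        Finset.sum_singleton, ← Finset.mul_sum]
      field_simp
      ring
    · simp only [Fintype.sum_sum_type, Sum.elim_inl, Sum.elim_inr, Finset.univ_unique,
        Finset.sum_singleton, Prod.ext_iff, Prod.fst_add, Prod.snd_add, Prod.fst_sum,
        Prod.snd_sum, Prod.smul_fst, Prod.smul_snd, mul_smul, ← Finset.smul_sum, hxb]
      refine ⟨by simp, ?_, by simp⟩
      simp only [smul_eq_mul, mul_one]
      ring
  · rintro ⟨w, hw, hw1, hwp⟩
    simp only [Fintype.sum_sum_type, Sum.elim_inl, Sum.elim_inr, Finset.univ_unique,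
      Finset.sum_singleton, Prod.ext_iff, Prod.fst_add, Prod.snd_add, Prod.fst_sum,
      Prod.snd_sum, Prod.smul_fst, Prod.smul_snd, smul_zero, Finset.sum_const_zero, add_zero,
      zero_add, smul_eq_mul, mul_one, mul_zero, smul_neg] at hwp
    obtain ⟨hu, hs, ht⟩ := hwp
    refine ⟨fun j => (N + 1) * w (Sum.inl (Sum.inl j)),
      fun j => mul_nonneg hN1.le (hw _), ?_, ?_⟩
    · simp only [mul_smul, ← Finset.smul_sum]
      rw [add_neg_eq_zero.1 hu, ht, smul_smul, mul_one_div_cancel hN1.ne', one_smul]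
    · rw [← Finset.mul_sum]
      have h0 := mul_nonneg hN1.le (hw (Sum.inl (Sum.inr default)))
      have hs' := congrArg ((N + 1) * ·) hs
      simp only [ht] at hs'
      field_simp at hs'
      linarith
end

section
/- Let 𝒜 ⊂ ℝ^m be a nonempty finite set whose convex hull has Euclidean diameter D > 0, p ∈ ℝ^m, and p_k ∈ conv(𝒜) with p_k ≠ p. Let v_j ∈ 𝒜 minimize vᵀ(p_k − p) over v ∈ 𝒜 and assume v_j ≠ p_k; set γ̄ = −(p_k − p)ᵀ(v_j − p_k)/‖v_j − p_k‖² and δ̂ = 2‖v_j − p_k‖²/D². If v_i ∈ 𝒜 is a pivot, i.e. ‖v_i − p‖ ≤ ‖v_i − p_k‖, then (p_k − p)ᵀ(v_i − p_k) ≤ −(1/2)‖p_k − p‖² ≤ 0 = min_{y ∈ conv(𝒜)} (p_k − p)ᵀ(y − p_k) + (1/2) γ̄ D² δ̂. Hence every pivot of the Triangle Algorithm is an inexact solution of the Frank–Wolfe subproblem for Ψ(y) = ½‖y − p‖² with inexactness parameter δ̂. -/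
open scoped RealInnerProductSpace

/-- A pivot of the Triangle Algorithm is an inexact solution of the Frank–Wolfe
subproblem for `Ψ(y) = ½‖y - p‖²`. Let `conv(𝒜)` have diameter `D > 0`, `p_k ∈ conv(𝒜)`
with `p_k ≠ p`, let `v_j ∈ 𝒜` minimize `v ↦ ⟪v, p_k - p⟫` over `𝒜` with `v_j ≠ p_k`, and
set `γ̄ = -⟪p_k - p, v_j - p_k⟫/‖v_j - p_k‖²` and `δ̂ = 2‖v_j - p_k‖²/D²`. If
`v_i ∈ 𝒜` is a pivot, i.e. `‖v_i - p‖ ≤ ‖v_i - p_k‖`, then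
`⟪p_k - p, v_i - p_k⟫ ≤ -(1/2)‖p_k - p‖² ≤ 0 = min_{y ∈ conv(𝒜)} ⟪p_k - p, y - p_k⟫
+ ½γ̄D²δ̂`, where the minimum is attained at `v_j`. -/
theorem pivot_is_inexact_fw {m : ℕ} (𝒜 : Finset (EuclideanSpace ℝ (Fin m)))
    (h𝒜 : 𝒜.Nonempty) (p : EuclideanSpace ℝ (Fin m)) (D : ℝ) (hDpos : 0 < D)
    (hD : D = Metric.diam (convexHull ℝ (𝒜 : Set (EuclideanSpace ℝ (Fin m)))))
    (pk : EuclideanSpace ℝ (Fin m))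
    (hpk : pk ∈ convexHull ℝ (𝒜 : Set (EuclideanSpace ℝ (Fin m)))) (hne : pk ≠ p)
    (vj : EuclideanSpace ℝ (Fin m)) (hvj : vj ∈ 𝒜) (hvjne : vj ≠ pk)
    (hvjmin : ∀ v ∈ 𝒜, ⟪vj, pk - p⟫ ≤ ⟪v, pk - p⟫)
    (γbar δhat : ℝ)
    (hγbar : γbar = -⟪pk - p, vj - pk⟫ / ‖vj - pk‖ ^ 2)
    (hδhat : δhat = 2 * ‖vj - pk‖ ^ 2 / D ^ 2)
    (vi : EuclideanSpace ℝ (Fin m)) (hvi : vi ∈ 𝒜)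
    (hpivot : ‖vi - p‖ ≤ ‖vi - pk‖) :
    ⟪pk - p, vi - pk⟫ ≤ -(1 / 2) * ‖pk - p‖ ^ 2 ∧
    -(1 / 2) * ‖pk - p‖ ^ 2 ≤ 0 ∧
    IsLeast {r : ℝ | ∃ y ∈ convexHull ℝ (𝒜 : Set (EuclideanSpace ℝ (Fin m))),
      r = ⟪pk - p, y - pk⟫} ⟪pk - p, vj - pk⟫ ∧
    (0 : ℝ) = ⟪pk - p, vj - pk⟫ + 1 / 2 * γbar * D ^ 2 * δhat := by
  refine ⟨?_, by nlinarith [sq_nonneg ‖pk - p‖], ⟨⟨vj, subset_convexHull ℝ _ hvj, rfl⟩, ?_⟩, ?_⟩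
  · have hsplit : vi - p = (pk - p) + (vi - pk) := by abel
    have hexp := norm_add_sq_real (pk - p) (vi - pk)
    rw [← hsplit] at hexp
    have hsq : ‖vi - p‖ ^ 2 ≤ ‖vi - pk‖ ^ 2 := by gcongr
    linarith
  · rintro r ⟨y, hy, rfl⟩
    have hhalf : Convex ℝ {x | ⟪pk - p, vj⟫ ≤ ⟪pk - p, x⟫} :=
      convex_halfSpace_ge (innerₛₗ ℝ (pk - p)).isLinear _
    have hsub : (𝒜 : Set (EuclideanSpace ℝ (Fin m))) ⊆ {x | ⟪pk - p, vj⟫ ≤ ⟪pk - p, x⟫} := by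
      intro v hv
      simpa only [Set.mem_ofPred_eq, real_inner_comm] using hvjmin v hv
    have hmin : ⟪pk - p, vj⟫ ≤ ⟪pk - p, y⟫ := convexHull_min hsub hhalf hy
    rw [inner_sub_right, inner_sub_right]
    linarith
  · have hnorm : ‖vj - pk‖ ≠ 0 := norm_ne_zero_iff.mpr (sub_ne_zero.mpr hvjne)
    have hD0 : D ≠ 0 := hDpos.ne'
    rw [hγbar, hδhat]
    field_simp
    ring
end
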